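/- Let η : ℝ² → ℝ be a smooth function whose support is contained in the closed unit disk. Then for every (φ, ψ) ∈ [0, 2π) × (0, π/2), the first moment longitudinal V-line transform of the gradient field dη := (∂η/∂x₁, ∂η/∂x₂) satisfies L¹(dη)(φ, ψ) = −Rη(sin ψ, φ − ψ + π/2) − Rη(sin ψ, φ + ψ − π/2). -/

import Mathlib

open Real MeasureTheory Set

noncomputable section

/-- The unit vector at polar angle `θ`. -/
def Phi (θ : ℝ) : ℝ × ℝ := (Real.cos θ, Real.sin θ)

/-- Rotation of a vector by 90° counterclockwise. -/
def perp (w : ℝ × ℝ) : ℝ × ℝ := (-w.2, w.1)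

/-- Euclidean dot product on `ℝ × ℝ`. -/
def dot (a b : ℝ × ℝ) : ℝ := a.1 * b.1 + a.2 * b.2

/-- The open unit disk in the plane. -/
def unitDisk : Set (ℝ × ℝ) := {x | x.1 ^ 2 + x.2 ^ 2 < 1}

/-- The closed unit disk in the plane. -/
def closedUnitDisk : Set (ℝ × ℝ) := {x | x.1 ^ 2 + x.2 ^ 2 ≤ 1}

/-- The unit circle in the plane. -/
def unitCircle : Set (ℝ × ℝ) := {x | x.1 ^ 2 + x.2 ^ 2 = 1}

/-- The Radon transform of a scalar function. -/
def radon (h : ℝ × ℝ → ℝ) (s θ : ℝ) : ℝ :=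
  ∫ t : ℝ, h (s • Phi θ + t • Phi (θ + π / 2))

/-- The weighted V-line transform of a scalar function, with weights `c₁, c₂`. -/
def Vw (c₁ c₂ : ℝ) (h : ℝ × ℝ → ℝ) (φ ψ : ℝ) : ℝ :=
  c₁ * (∫ t in Ioi (0 : ℝ), h (Phi φ + t • Phi (π + φ - ψ))) +
  c₂ * (∫ t in Ioi (0 : ℝ), h (Phi φ + t • Phi (π + φ + ψ)))

/-- The `n`-th (complex) Fourier coefficient of a function of the angular variable. -/
def fourierCoeff' (g : ℝ → ℝ) (n : ℤ) : ℂ :=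
  (1 / (2 * (π : ℂ))) * ∫ φ in (0 : ℝ)..(2 * π), (g φ : ℂ) * Complex.exp (-Complex.I * n * φ)

/-- The gradient `dV = (∂V/∂x₁, ∂V/∂x₂)` of a scalar function. -/
def grad (V : ℝ × ℝ → ℝ) (x : ℝ × ℝ) : ℝ × ℝ :=
  (fderiv ℝ V x (1, 0), fderiv ℝ V x (0, 1))

/-- The orthogonal gradient `d⊥V = (−∂V/∂x₂, ∂V/∂x₁)` of a scalar function. -/
def gradPerp (V : ℝ × ℝ → ℝ) (x : ℝ × ℝ) : ℝ × ℝ :=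
  (-(fderiv ℝ V x (0, 1)), fderiv ℝ V x (1, 0))

/-- The longitudinal V-line transform of a vector field. -/
def Lvec (f : ℝ × ℝ → ℝ × ℝ) (φ ψ : ℝ) : ℝ :=
  (∫ t in Ioi (0 : ℝ), dot (Phi (π + φ - ψ)) (f (Phi φ + t • Phi (π + φ - ψ)))) +
  (∫ t in Ioi (0 : ℝ), dot (Phi (π + φ + ψ)) (f (Phi φ + t • Phi (π + φ + ψ))))

/-- The transverse V-line transform of a vector field. -/
def Tvec (f : ℝ × ℝ → ℝ × ℝ) (φ ψ : ℝ) : ℝ :=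
  (∫ t in Ioi (0 : ℝ), dot (perp (Phi (π + φ - ψ))) (f (Phi φ + t • Phi (π + φ - ψ)))) +
  (∫ t in Ioi (0 : ℝ), dot (perp (Phi (π + φ + ψ))) (f (Phi φ + t • Phi (π + φ + ψ))))

/-- The `k`-th moment longitudinal V-line transform of a vector field. -/
def LvecMoment (k : ℕ) (f : ℝ × ℝ → ℝ × ℝ) (φ ψ : ℝ) : ℝ :=
  (∫ t in Ioi (0 : ℝ), t ^ k * dot (Phi (π + φ - ψ)) (f (Phi φ + t • Phi (π + φ - ψ)))) +
  (∫ t in Ioi (0 : ℝ), t ^ k * dot (Phi (π + φ + ψ)) (f (Phi φ + t • Phi (π + φ + ψ))))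

/-- Integration by parts against the identity for a compactly supported function vanishing on
the negative half-line. -/
theorem integral_Ioi_mul_deriv_eq_neg_integral {g : ℝ → ℝ} (hg : ContDiff ℝ 1 g)
    (hc : HasCompactSupport g) (hneg : ∀ t < 0, g t = 0) :
    ∫ t in Ioi (0 : ℝ), t * deriv g t = -∫ t, g t := by
  have hcont : Continuous (deriv g) := hg.continuous_deriv le_rfl
  have hderiv : ∀ t < 0, deriv g t = 0 := fun t ht => by
    have h : g =ᶠ[nhds t] fun _ => 0 :=
      Filter.eventually_of_mem (Iio_mem_nhds ht) fun s hs => hneg s hs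
    simpa using h.deriv_eq
  rw [setIntegral_eq_integral_of_forall_compl_eq_zero]
  · have hparts := integral_mul_deriv_eq_deriv_mul_of_integrable (u := fun t : ℝ => t) (v := g)
      (u' := fun _ => 1) (v' := deriv g) (fun t _ => hasDerivAt_id t)
      (fun t _ => (hg.differentiable one_ne_zero t).hasDerivAt)
      ((continuous_id.mul hcont).integrable_of_hasCompactSupport hc.deriv.mul_left)
      ((continuous_const.mul hg.continuous).integrable_of_hasCompactSupport hc.mul_left)
      ((continuous_id.mul hg.continuous).integrable_of_hasCompactSupport hc.mul_left)
    simpa using hparts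
  · intro t ht
    rcases (not_lt.mp (mt mem_Ioi.mpr ht)).lt_or_eq with h | rfl
    · rw [hderiv t h, mul_zero]
    · exact zero_mul _

theorem dot_grad (V : ℝ × ℝ → ℝ) (w x : ℝ × ℝ) : dot w (grad V x) = fderiv ℝ V x w := by
  have hw : w = w.1 • ((1, 0) : ℝ × ℝ) + w.2 • ((0, 1) : ℝ × ℝ) := by
    ext <;> simp
  conv_rhs => rw [hw]
  simp only [dot, grad, map_add, map_smul, smul_eq_mul]

/-- The first moment ray transform of a gradient, along a unit-speed ray which leaves a boundary
point of the unit disk and does not point outwards, is minus the integral of the potential over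
the whole line. -/
theorem integral_Ioi_mul_dot_grad {η : ℝ × ℝ → ℝ} (hη : ContDiff ℝ 1 η)
    (hsupp : Function.support η ⊆ closedUnitDisk) {p w : ℝ × ℝ}
    (hp : dot p p = 1) (hw : dot w w = 1) (hpw : dot p w ≤ 0) :
    ∫ t in Ioi (0 : ℝ), t ^ 1 * dot w (grad η (p + t • w)) = -∫ t : ℝ, η (p + t • w) := by
  have hzero : ∀ t : ℝ, t ∉ Icc 0 (-2 * dot p w) → η (p + t • w) = 0 := by
    intro t ht
    by_contra hne
    have hmem : (p.1 + t * w.1) ^ 2 + (p.2 + t * w.2) ^ 2 ≤ 1 := hsupp hne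
    have hquad : t * (t + 2 * dot p w) ≤ 0 := by
      simp only [dot] at *
      linear_combination hmem - hp - t ^ 2 * hw
    refine ht ⟨?_, ?_⟩ <;> by_contra! hlt <;> nlinarith
  have hη' : ContDiff ℝ 1 fun t : ℝ => η (p + t • w) :=
    hη.comp (contDiff_const.add (contDiff_id.smul contDiff_const))
  rw [← integral_Ioi_mul_deriv_eq_neg_integral hη'
    (HasCompactSupport.intro isCompact_Icc hzero)
    (fun t ht => hzero t fun h => ht.not_ge h.1)]
  congr 1
  ext t
  have hline : HasDerivAt (fun t : ℝ => p + t • w) w t := by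
    simpa using ((hasDerivAt_id t).smul_const w).const_add p
  have hcomp : HasDerivAt (fun t : ℝ => η (p + t • w)) (fderiv ℝ η (p + t • w) w) t :=
    (hη.differentiable one_ne_zero _).hasFDerivAt.comp_hasDerivAt t hline
  rw [pow_one, dot_grad, hcomp.deriv]

theorem dot_Phi (α β : ℝ) : dot (Phi α) (Phi β) = cos (α - β) := by
  rw [cos_sub]; rfl

/-- Expansion of a unit vector in the orthonormal frame at angle `θ`. -/
theorem Phi_eq_smul_add_smul (φ θ : ℝ) :
    Phi φ = cos (φ - θ) • Phi θ + sin (φ - θ) • Phi (θ + π / 2) := by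
  have h : φ = (φ - θ) + θ := by ring
  ext
  · simp only [Phi, Prod.fst_add, Prod.smul_fst, smul_eq_mul, cos_add_pi_div_two]
    conv_lhs => rw [h, cos_add]
    ring
  · simp only [Phi, Prod.snd_add, Prod.smul_snd, smul_eq_mul, sin_add_pi_div_two]
    conv_lhs => rw [h, sin_add]
    ring

theorem Phi_add_pi (θ : ℝ) : Phi (θ + π) = -Phi θ := by
  ext <;> simp [Phi]

theorem integral_line_forward (h : ℝ × ℝ → ℝ) (φ ψ : ℝ) :
    ∫ t : ℝ, h (Phi φ + t • Phi (π + φ - ψ)) = radon h (sin ψ) (φ - ψ + π / 2) := by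
  rw [radon, ← integral_add_right_eq_self _ (cos ψ)]
  congr 1
  ext t
  have hdir : φ - ψ + π / 2 + π / 2 = π + φ - ψ := by ring
  have hang : φ - (φ - ψ + π / 2) = ψ - π / 2 := by ring
  have hframe := Phi_eq_smul_add_smul φ (φ - ψ + π / 2)
  rw [hang, cos_sub_pi_div_two, sin_sub_pi_div_two, hdir] at hframe
  rw [hframe, hdir]
  congr 1
  module

theorem integral_line_backward (h : ℝ × ℝ → ℝ) (φ ψ : ℝ) :
    ∫ t : ℝ, h (Phi φ + t • Phi (π + φ + ψ)) = radon h (sin ψ) (φ + ψ - π / 2) := by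
  rw [radon, ← integral_sub_left_eq_self _ volume (cos ψ)]
  congr 1
  ext t
  have hdir : φ + ψ - π / 2 + π / 2 = φ + ψ := by ring
  have hang : φ - (φ + ψ - π / 2) = π / 2 - ψ := by ring
  have hopp : π + φ + ψ = φ + ψ + π := by ring
  have hframe := Phi_eq_smul_add_smul φ (φ + ψ - π / 2)
  rw [hang, cos_pi_div_two_sub, sin_pi_div_two_sub, hdir] at hframe
  rw [hframe, hdir, hopp, Phi_add_pi]
  congr 1
  module

/-- the first moment longitudinal V-line transform of a gradient field in terms
of the Radon transform of the potential. -/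
theorem moment_Lvec_grad (η : ℝ × ℝ → ℝ) (hsm : ContDiff ℝ (⊤ : ℕ∞) η)
    (hsupp : Function.support η ⊆ closedUnitDisk)
    (φ ψ : ℝ) (hφ : φ ∈ Ico 0 (2 * π)) (hψ : ψ ∈ Ioo 0 (π / 2)) :
    LvecMoment 1 (grad η) φ ψ =
      -radon η (Real.sin ψ) (φ - ψ + π / 2) - radon η (Real.sin ψ) (φ + ψ - π / 2) := by
  have hcos : 0 ≤ cos ψ := cos_nonneg_of_mem_Icc ⟨by linarith [hψ.1, pi_pos], hψ.2.le⟩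
  have hη : ContDiff ℝ 1 η := hsm.of_le (by exact_mod_cast le_top)
  have hu : dot (Phi φ) (Phi (π + φ - ψ)) ≤ 0 := by
    rw [dot_Phi, show φ - (π + φ - ψ) = ψ - π by ring, cos_sub_pi]
    linarith
  have hv : dot (Phi φ) (Phi (π + φ + ψ)) ≤ 0 := by
    rw [dot_Phi, show φ - (π + φ + ψ) = -(ψ + π) by ring, cos_neg, cos_add_pi]
    linarith
  have hunit : ∀ θ, dot (Phi θ) (Phi θ) = 1 := fun θ => by
    rw [dot_Phi, sub_self, cos_zero]
  rw [LvecMoment, integral_Ioi_mul_dot_grad hη hsupp (hunit _) (hunit _) hu,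
    integral_Ioi_mul_dot_grad hη hsupp (hunit _) (hunit _) hv,
    integral_line_forward, integral_line_backward]
  ring
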